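/- Let k ≥ 1 be an integer and s > 0. Let D be a random variable with distribution N(0,s²) and T an independent random variable uniform on [−1/2, 1/2]. Then P( D + T ∈ ⋃_{l∈ℤ} [l·2^k − 2^{k−2}, l·2^k + 2^{k−2}] ) = 1/2 + Σ_{l=1}^{∞} exp(−(1/2)(πsl/2^{k−1})²) · sinc(l/2^k) · sinc(l/2). -/

import Mathlib

open MeasureTheory ProbabilityTheory Real Set

/-- The normalized sinc function: `sinc u = sin (π u) / (π u)` for `u ≠ 0`, `sinc 0 = 1`. -/
noncomputable def sinc (u : ℝ) : ℝ := if u = 0 then 1 else Real.sin (Real.pi * u) / (Real.pi * u)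

/-- The Fourier series of the periodized second Bernoulli polynomial. -/
lemma hasSum_cos_div_sq (x : ℝ) :
    HasSum (fun n : ℕ => Real.cos (2 * π * n * x) / (π ^ 2 * (n : ℝ) ^ 2))
      (Int.fract x ^ 2 - Int.fract x + 1 / 6) := by
  have h := (hasSum_one_div_nat_pow_mul_cos (k := 1) one_ne_zero
    (x := Int.fract x) ⟨Int.fract_nonneg x, (Int.fract_lt_one x).le⟩).mul_left (1 / π ^ 2)
  have hB := bernoulliFun_two (Int.fract x)
  rw [bernoulliFun] at hB
  simp only [mul_one] at h
  rw [hB] at h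
  have hπ : π ≠ 0 := Real.pi_ne_zero
  convert! h using 1
  · funext n
    have hc : Real.cos (2 * π * n * Int.fract x) = Real.cos (2 * π * n * x) := by
      have hx : 2 * π * n * Int.fract x = 2 * π * n * x - ((n * ⌊x⌋ : ℤ) : ℝ) * (2 * π) := by
        rw [Int.fract]
        push_cast
        ring
      rw [hx, Real.cos_sub_int_mul_two_pi]
    rw [hc]
    field_simp
  · norm_num
    field_simp

lemma intervalIntegrable_fract_add_div (p c a b : ℝ) :
    IntervalIntegrable (fun t : ℝ => Int.fract (c + t / p)) volume a b := by
  refine (intervalIntegrable_const (c := (1 : ℝ))).mono_fun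
    (by fun_prop : Measurable fun t : ℝ => Int.fract (c + t / p)).aestronglyMeasurable
    (.of_forall fun t => ?_)
  simpa [abs_of_nonneg] using (Int.fract_lt_one (c + t / p)).le

lemma integral_fract (a b : ℝ) :
    ∫ x in a..b, Int.fract x =
      (b - a) / 2 + ((Int.fract b ^ 2 - Int.fract b) - (Int.fract a ^ 2 - Int.fract a)) / 2 := by
  have hcont : Continuous fun x : ℝ => (Int.fract x ^ 2 - Int.fract x) :=
    ContinuousOn.comp_fract'' (f := fun x : ℝ => x ^ 2 - x) (by fun_prop) (by norm_num)
  have h := MeasureTheory.integral_eq_of_hasDerivAt_off_countable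
    (fun x : ℝ => x / 2 + (Int.fract x ^ 2 - Int.fract x) / 2) (fun x => Int.fract x)
    (a := a) (b := b) (s := Set.range ((↑) : ℤ → ℝ)) (Set.countable_range _)
    (by fun_prop) ?_ (by simpa using intervalIntegrable_fract_add_div 1 0 a b)
  · rw [h]
    ring
  · rintro x ⟨-, hx⟩
    have hlt : (⌊x⌋ : ℝ) < x := lt_of_le_of_ne (Int.floor_le x) fun h => hx ⟨_, h⟩
    have hev : (fun y : ℝ => y / 2 + ((y - ⌊x⌋) ^ 2 - (y - ⌊x⌋)) / 2) =ᶠ[nhds x]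
        fun y : ℝ => y / 2 + (Int.fract y ^ 2 - Int.fract y) / 2 := by
      filter_upwards [Ioo_mem_nhds hlt (Int.lt_floor_add_one x)] with y hy
      have : ⌊y⌋ = ⌊x⌋ := Int.floor_eq_iff.2 ⟨hy.1.le, hy.2⟩
      rw [Int.fract, this]
    refine HasDerivAt.congr_of_eventuallyEq ?_ hev.symm
    have h1 : HasDerivAt (fun y : ℝ => y - ⌊x⌋) 1 x := (hasDerivAt_id x).sub_const _
    convert! ((hasDerivAt_id x).div_const 2).add (((h1.pow 2).sub h1).div_const 2) using 1
    rw [Int.fract]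
    push_cast
    ring

/-- The indicator function of the reals at distance at most `1 / 4` from the integers. -/
noncomputable def nearInt (u : ℝ) : ℝ := 3 / 2 - Int.fract (1 / 4 + u) - Int.fract (1 / 4 - u)

lemma measurable_nearInt : Measurable nearInt := by
  unfold nearInt
  fun_prop

lemma nearInt_eq_indicator :
    nearInt = Set.indicator {u : ℝ | ∃ l : ℤ, u ∈ Set.Icc ((l : ℝ) - 1 / 4) (l + 1 / 4)} 1 := by
  funext u
  have h1 := Int.fract_nonneg (1 / 4 + u)
  have h2 := Int.fract_lt_one (1 / 4 + u)
  have h3 := Int.fract_nonneg (1 / 4 - u)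
  have h4 := Int.fract_lt_one (1 / 4 - u)
  have hval : nearInt u = ((1 + ⌊1 / 4 + u⌋ + ⌊1 / 4 - u⌋ : ℤ) : ℝ) := by
    rw [nearInt, Int.fract, Int.fract]
    push_cast
    ring
  have hsum : nearInt u = 3 / 2 - Int.fract (1 / 4 + u) - Int.fract (1 / 4 - u) := rfl
  rw [hval] at hsum ⊢
  by_cases hu : u ∈ {u : ℝ | ∃ l : ℤ, u ∈ Set.Icc ((l : ℝ) - 1 / 4) (l + 1 / 4)}
  · rw [Set.indicator_of_mem hu]
    obtain ⟨l, hl1, hl2⟩ := hu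
    have e1 : ⌊1 / 4 + u⌋ = l := Int.floor_eq_iff.2 ⟨by linarith, by linarith⟩
    have e2 : ⌊1 / 4 - u⌋ = -l :=
      Int.floor_eq_iff.2 ⟨by push_cast; linarith, by push_cast; linarith⟩
    rw [e1, e2]
    simp
  · rw [Set.indicator_of_notMem hu]
    have hle : ((1 + ⌊1 / 4 + u⌋ + ⌊1 / 4 - u⌋ : ℤ) : ℝ) < 2 := by linarith
    have hge : (-1 : ℝ) < ((1 + ⌊1 / 4 + u⌋ + ⌊1 / 4 - u⌋ : ℤ) : ℝ) := by linarith
    have hne : 1 + ⌊1 / 4 + u⌋ + ⌊1 / 4 - u⌋ ≠ 1 := by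
      intro h
      apply hu
      have e : ⌊1 / 4 - u⌋ = -⌊1 / 4 + u⌋ := by lia
      have f1 := Int.floor_le (1 / 4 + u)
      have f2 := Int.floor_le (1 / 4 - u)
      rw [e] at f2
      push_cast at f2
      exact ⟨⌊1 / 4 + u⌋, by linarith, by linarith⟩
    have hle' : 1 + ⌊1 / 4 + u⌋ + ⌊1 / 4 - u⌋ < 2 := by exact_mod_cast hle
    have hge' : -1 < 1 + ⌊1 / 4 + u⌋ + ⌊1 / 4 - u⌋ := by exact_mod_cast hge
    have : 1 + ⌊1 / 4 + u⌋ + ⌊1 / 4 - u⌋ = 0 := by lia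
    rw [this, Int.cast_zero]

lemma norm_nearInt_le (u : ℝ) : ‖nearInt u‖ ≤ 1 := by
  rw [nearInt_eq_indicator]
  exact (norm_indicator_le_norm_self _ _).trans (by simp)

lemma integral_fract_add_div {p : ℝ} (hp : 0 < p) (c : ℝ) :
    ∫ t in (-(1 / 2) : ℝ)..(1 / 2), Int.fract (c + t / p) =
      1 / 2 + p / 2 * ((Int.fract (c + 1 / (2 * p)) ^ 2 - Int.fract (c + 1 / (2 * p))) -
        (Int.fract (c - 1 / (2 * p)) ^ 2 - Int.fract (c - 1 / (2 * p)))) := by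
  rw [intervalIntegral.integral_comp_add_div (fun x : ℝ => Int.fract x) hp.ne', integral_fract,
    show c + -(1 / 2) / p = c - 1 / (2 * p) by field_simp; ring,
    show c + 1 / 2 / p = c + 1 / (2 * p) by field_simp, smul_eq_mul]
  generalize Int.fract (c + 1 / (2 * p)) = A
  generalize Int.fract (c - 1 / (2 * p)) = B
  field_simp
  ring

/-- The Fourier series of the moving average of `x ↦ nearInt (x / p)` over unit intervals. -/
lemma hasSum_integral_nearInt {p : ℝ} (hp : 0 < p) (x : ℝ) :
    HasSum (fun n : ℕ => _root_.sinc ((n + 1) / p) * _root_.sinc ((n + 1) / 2) *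
        Real.cos (2 * π * (n + 1) / p * x))
      ((∫ t in (-(1 / 2) : ℝ)..(1 / 2), nearInt ((x + t) / p)) - 1 / 2) := by
  have hint : ∫ t in (-(1 / 2) : ℝ)..(1 / 2), nearInt ((x + t) / p) =
      3 / 2 - (∫ t in (-(1 / 2) : ℝ)..(1 / 2), Int.fract ((1 / 4 + x / p) + t / p)) -
        ∫ t in (-(1 / 2) : ℝ)..(1 / 2), Int.fract ((1 / 4 - x / p) + t / p) := by
    have hneg : ∫ t in (-(1 / 2) : ℝ)..(1 / 2), Int.fract ((1 / 4 - x / p) + t / p) =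
        ∫ t in (-(1 / 2) : ℝ)..(1 / 2), Int.fract ((1 / 4 - x / p) + (-t) / p) := by
      have := intervalIntegral.integral_comp_neg (a := (-(1 / 2) : ℝ)) (b := 1 / 2)
        (fun t : ℝ => Int.fract ((1 / 4 - x / p) + t / p))
      rw [this, neg_neg]
    have hi : IntervalIntegrable (fun t : ℝ => Int.fract ((1 / 4 - x / p) + (-t) / p)) volume
        (-(1 / 2)) (1 / 2) := by
      convert! intervalIntegrable_fract_add_div (-p) (1 / 4 - x / p) (-(1 / 2)) (1 / 2) using 3
      rw [neg_div, div_neg]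
    have hsplit := intervalIntegral.integral_sub
      ((intervalIntegrable_const (c := (3 / 2 : ℝ))).sub
        (intervalIntegrable_fract_add_div p (1 / 4 + x / p) (-(1 / 2)) (1 / 2))) hi
    rw [intervalIntegral.integral_sub intervalIntegrable_const
      (intervalIntegrable_fract_add_div _ _ _ _), intervalIntegral.integral_const] at hsplit
    rw [hneg]
    convert! hsplit using 1
    · refine intervalIntegral.integral_congr fun t _ => ?_
      simp only [nearInt]
      ring_nf
    · norm_num
  have hs (c : ℝ) := (hasSum_cos_div_sq (c + 1 / (2 * p))).sub (hasSum_cos_div_sq (c - 1 / (2 * p)))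
  have hS := ((hs (1 / 4 + x / p)).add (hs (1 / 4 - x / p))).mul_left (-(p / 2))
  rw [← hasSum_nat_add_iff' 1] at hS
  rw [hint, integral_fract_add_div hp, integral_fract_add_div hp]
  convert! hS using 1
  · funext n
    have hn : (n : ℝ) + 1 ≠ 0 := by positivity
    have hp0 := hp.ne'
    have hπ := Real.pi_ne_zero
    simp only [_root_.sinc, div_eq_zero_iff, hn, hp0, two_ne_zero, or_self, if_false]
    have hd (c : ℝ) : Real.cos (2 * π * (n + 1) * (c + 1 / (2 * p))) -
        Real.cos (2 * π * (n + 1) * (c - 1 / (2 * p))) =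
        -2 * Real.sin (2 * π * (n + 1) * c) * Real.sin (π * ((n + 1) / p)) := by
      rw [Real.cos_sub_cos]
      congr 2
      · ring_nf
      · field_simp
        ring
    have hsin : Real.sin (2 * π * (n + 1) * (1 / 4 + x / p)) +
        Real.sin (2 * π * (n + 1) * (1 / 4 - x / p)) =
        2 * Real.sin (π * ((n + 1) / 2)) * Real.cos (2 * π * (n + 1) / p * x) := by
      rw [Real.two_mul_sin_mul_cos, add_comm]
      congr 2 <;> ring
    push_cast
    rw [← sub_div, ← sub_div, hd, hd, ← add_div, ← add_mul, ← mul_add, hsin]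
    field_simp
  · simp [-one_div]
    ring

lemma integral_cos_gaussianReal (v : NNReal) (c : ℝ) :
    ∫ x, Real.cos (c * x) ∂gaussianReal 0 v = Real.exp (-(v * c ^ 2 / 2)) := by
  have h := charFun_gaussianReal (μ := 0) (v := v) c
  rw [charFun_apply_real] at h
  have hint : Integrable (fun x : ℝ => Complex.exp (c * x * Complex.I)) (gaussianReal 0 v) := by
    refine Integrable.of_bound (by fun_prop) 1 (.of_forall fun x => ?_)
    rw [← Complex.ofReal_mul, Complex.norm_exp_ofReal_mul_I]
  have h' := congrArg Complex.re h
  rw [← RCLike.re_eq_complex_re, ← integral_re hint] at h'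
  convert! h' using 1
  · refine integral_congr_ae (.of_forall fun x => ?_)
    simp only [RCLike.re_eq_complex_re]
    rw [← Complex.ofReal_mul, Complex.exp_ofReal_mul_I_re]
  · rw [← Complex.exp_ofReal_re]
    simp

/-- The integral of the `p`-periodic indicator `x ↦ nearInt (x / p)` against the convolution of
a centred Gaussian law and the uniform law on `[-1/2, 1/2]`. -/
lemma integral_gaussianReal_integral_nearInt {p : ℝ} (hp : 0 < p) (v : NNReal) :
    ∫ x, (∫ t in (-(1 / 2) : ℝ)..(1 / 2), nearInt ((x + t) / p)) ∂gaussianReal 0 v =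
      1 / 2 + ∑' n : ℕ, Real.exp (-(v * (2 * π * (n + 1) / p) ^ 2 / 2)) *
        _root_.sinc ((n + 1) / p) * _root_.sinc ((n + 1) / 2) := by
  set F : ℕ → ℝ → ℝ := fun n x => _root_.sinc ((n + 1) / p) * _root_.sinc ((n + 1) / 2) *
    Real.cos (2 * π * (n + 1) / p * x) with hF
  have hbound (n : ℕ) (x : ℝ) : ‖F n x‖ ≤ |F n 0| := by
    simp only [hF, mul_zero, Real.cos_zero, mul_one, norm_mul, Real.norm_eq_abs, abs_mul]
    exact mul_le_of_le_one_right (by positivity) (Real.abs_cos_le_one _)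
  have hFi (n : ℕ) : Integrable (F n) (gaussianReal 0 v) :=
    Integrable.of_bound (by fun_prop) _ (.of_forall (hbound n))
  have hsum : Summable fun n => ∫ x, ‖F n x‖ ∂gaussianReal 0 v := by
    refine (hasSum_integral_nearInt hp 0).summable.abs.of_nonneg_of_le
      (fun n => integral_nonneg fun x => norm_nonneg _) fun n => ?_
    refine (integral_mono (hFi n).norm (integrable_const _) (hbound n)).trans ?_
    simp [hF]
  have hlim := hasSum_integral_of_summable_integral_norm hFi hsum
  have hint : Integrable (fun x => ∑' n, F n x) (gaussianReal 0 v) := by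
    refine Integrable.of_bound ?_ (∑' n, |F n 0|) (.of_forall fun x => ?_)
    · exact (continuous_tsum (fun n => by fun_prop) (hasSum_integral_nearInt hp 0).summable.abs
        hbound).aestronglyMeasurable
    · exact tsum_of_norm_bounded (hasSum_integral_nearInt hp 0).summable.abs.hasSum fun n => hbound n x
  have heq (x : ℝ) : ∫ t in (-(1 / 2) : ℝ)..(1 / 2), nearInt ((x + t) / p) =
      1 / 2 + ∑' n, F n x := by
    rw [(hasSum_integral_nearInt hp x).tsum_eq]
    ring
  simp_rw [heq]
  rw [integral_add (integrable_const _) hint, ← hlim.tsum_eq]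
  congr 1
  · simp
  · refine tsum_congr fun n => ?_
    simp only [hF]
    rw [integral_const_mul, integral_cos_gaussianReal]
    ring

/-- For `D ~ N(0,s²)` and `T` uniform on `[−1/2, 1/2]` independent of `D`, the probability that
`D + T` lands in the `2^k`-periodic union of intervals of width `2^{k−1}` equals
`1/2 + Σ_{l≥1} exp(−(1/2)(πsl/2^{k−1})²) sinc(l/2^k) sinc(l/2)`. -/
theorem prob_sum_in_consistent_intervals
    {Ω : Type*} [MeasurableSpace Ω] (P : Measure Ω) [IsProbabilityMeasure P]
    (k : ℕ) (hk : 1 ≤ k) (s : ℝ) (hs : 0 < s)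
    (D T : Ω → ℝ) (hD_meas : Measurable D) (hT_meas : Measurable T)
    (hD : Measure.map D P = gaussianReal 0 ⟨s ^ 2, sq_nonneg s⟩)
    (hT : Measure.map T P = volume.restrict (Set.Icc (-(1 / 2) : ℝ) (1 / 2)))
    (hindep : IndepFun D T P) :
    P {ω | ∃ l : ℤ, D ω + T ω ∈
        Set.Icc ((l : ℝ) * 2 ^ k - 2 ^ ((k : ℤ) - 2)) ((l : ℝ) * 2 ^ k + 2 ^ ((k : ℤ) - 2))} =
      ENNReal.ofReal (1 / 2 + ∑' l : ℕ,
        Real.exp (-(1 / 2) * (Real.pi * s * (l + 1) / 2 ^ (k - 1)) ^ 2) *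
          _root_.sinc ((l + 1) / 2 ^ k) * _root_.sinc ((l + 1) / 2)) := by
  obtain ⟨v, hv, hvs⟩ : ∃ v : NNReal, Measure.map D P = gaussianReal 0 v ∧ (v : ℝ) = s ^ 2 :=
    ⟨⟨s ^ 2, sq_nonneg s⟩, hD, rfl⟩
  have hp : (0 : ℝ) < 2 ^ k := by positivity
  set S := {u : ℝ | ∃ l : ℤ, u ∈ Set.Icc ((l : ℝ) - 1 / 4) (l + 1 / 4)} with hS
  have hSmeas : MeasurableSet S := by
    simp only [hS, Set.ofPred_exists]
    exact MeasurableSet.iUnion fun l => measurableSet_Icc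
  have hset : {ω | ∃ l : ℤ, D ω + T ω ∈ Set.Icc ((l : ℝ) * 2 ^ k - 2 ^ ((k : ℤ) - 2))
      ((l : ℝ) * 2 ^ k + 2 ^ ((k : ℤ) - 2))} = (fun ω => (D ω + T ω) / 2 ^ k) ⁻¹' S := by
    ext ω
    have hpow : (2 : ℝ) ^ ((k : ℤ) - 2) = 1 / 4 * 2 ^ k := by
      rw [zpow_sub₀ two_ne_zero, zpow_natCast]
      norm_num
      ring
    simp only [hS, Set.mem_preimage, Set.mem_ofPred_eq, Set.mem_Icc, hpow, le_div_iff₀ hp,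
      div_le_iff₀ hp, sub_mul, add_mul]
  have hmeas : Measurable fun ω => (D ω + T ω) / 2 ^ k := by fun_prop
  have hreal : P.real ((fun ω => (D ω + T ω) / 2 ^ k) ⁻¹' S) =
      ∫ ω, nearInt ((D ω + T ω) / 2 ^ k) ∂P := by
    rw [nearInt_eq_indicator, ← integral_indicator_one (hmeas hSmeas)]
    rfl
  have hlaw : Measure.map (fun ω => (D ω, T ω)) P = (gaussianReal 0 v).prod
      (volume.restrict (Set.Icc (-(1 / 2) : ℝ) (1 / 2))) := by
    rw [← hv, ← hT]
    exact (indepFun_iff_map_prod_eq_prod_map_map hD_meas.aemeasurable hT_meas.aemeasurable).1 hindep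
  have hgmeas : Measurable fun z : ℝ × ℝ => nearInt ((z.1 + z.2) / 2 ^ k) :=
    measurable_nearInt.comp (by fun_prop)
  have hprod : ∫ ω, nearInt ((D ω + T ω) / 2 ^ k) ∂P =
      ∫ x, (∫ t in (-(1 / 2) : ℝ)..(1 / 2), nearInt ((x + t) / 2 ^ k))
        ∂gaussianReal 0 v := by
    rw [← integral_map (φ := fun ω => (D ω, T ω)) (by fun_prop)
      (f := fun z : ℝ × ℝ => nearInt ((z.1 + z.2) / 2 ^ k)) hgmeas.aestronglyMeasurable, hlaw,
      integral_prod _ (Integrable.of_bound hgmeas.aestronglyMeasurable 1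
        (.of_forall fun z => norm_nearInt_le _))]
    refine integral_congr_ae (.of_forall fun x => ?_)
    simp only
    rw [intervalIntegral.integral_of_le (by norm_num), integral_Icc_eq_integral_Ioc]
  rw [hset, ← ofReal_measureReal, hreal, hprod, integral_gaussianReal_integral_nearInt hp]
  congr 2
  refine tsum_congr fun n => ?_
  congr 3
  obtain ⟨m, rfl⟩ := Nat.exists_eq_add_of_le' hk
  simp only [Nat.add_sub_cancel, hvs]
  rw [pow_succ]
  field_simp
  ring
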